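/- For every integer n ≥ 3 and every vertex u ∈ V, the probability of the event E_u — that there exists a four-cycle rooted at u at least one of whose four edges is long-range — satisfies Pr(E_u) < (70/9)·ln(n/2)^{−1} + ((65/2)·ζ(3) + 403/128)·ln(n/2)^{−2} + (24·ζ(3) + 8)·(ln n + 1)·ln(n/2)^{−3} + ((3/4)·ζ(3) + 1/4)·(ln n + 1)²·ln(n/2)^{−4}. In particular, Pr(E_u) = O(1/log n) as n → ∞. -/

import Mathlib

open scoped Classical
open Finset

/-- Vertex set of the `n × n` torus. -/
abbrev Vx (n : ℕ) := Fin n × Fin n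

/-- Toroidal distance on the `n × n` torus. -/
def tdist (n : ℕ) (u v : Vx n) : ℕ :=
  min ((u.1 : ℤ) - (v.1 : ℤ)).natAbs (n - ((u.1 : ℤ) - (v.1 : ℤ)).natAbs) +
  min ((u.2 : ℤ) - (v.2 : ℤ)).natAbs (n - ((u.2 : ℤ) - (v.2 : ℤ)).natAbs)

/-- The normalizing factor at vertex `u`. -/
noncomputable def Zfac (n : ℕ) (u : Vx n) : ℝ :=
  (∑ w ∈ univ.filter (fun w => w ≠ u), ((tdist n u w : ℝ) ^ 2)⁻¹)⁻¹

/-- The probability mass of the outcome `c : V → V` (the vector of long-range choices)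
under the UTSW product measure: each vertex `u` independently chooses `c u = v ≠ u`
with probability `Z · d(u,v)⁻²`. -/
noncomputable def mass (n : ℕ) (c : Vx n → Vx n) : ℝ :=
  ∏ u : Vx n, if c u = u then 0 else Zfac n u * ((tdist n u (c u) : ℝ) ^ 2)⁻¹

/-- Probability of an event under the UTSW product measure. -/
noncomputable def Pr (n : ℕ) (E : Set (Vx n → Vx n)) : ℝ :=
  ∑ c : Vx n → Vx n, if c ∈ E then mass n c else 0

/-- `{x, y}` is an edge of the UTSW random graph `G(c)`. -/
def isEdge (n : ℕ) (c : Vx n → Vx n) (x y : Vx n) : Prop :=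
  x ≠ y ∧ (tdist n x y = 1 ∨ c x = y ∨ c y = x)

/-- `{x, y}` is an edge of `G(c)` of the given kind: local (`w = false`, distance one)
or long-range (`w = true`, distance not one). -/
def edgeKind (n : ℕ) (c : Vx n → Vx n) (x y : Vx n) (w : Bool) : Prop :=
  isEdge n c x y ∧ (tdist n x y = 1 ↔ w = false)

/-- There is a four-cycle rooted at `u` in `G(c)` whose edge sequence has the local/long-range
pattern `(p₁, p₂, p₃, p₄)` (`false` = local edge, `true` = long-range edge). -/
def cyclePat (n : ℕ) (c : Vx n → Vx n) (u : Vx n) (p₁ p₂ p₃ p₄ : Bool) : Prop :=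
  ∃ a b e : Vx n, a ≠ b ∧ a ≠ e ∧ b ≠ e ∧ a ≠ u ∧ b ≠ u ∧ e ≠ u ∧
    edgeKind n c u a p₁ ∧ edgeKind n c a b p₂ ∧ edgeKind n c b e p₃ ∧ edgeKind n c e u p₄

/-- `ζ(3) = ∑_{i ≥ 1} i⁻³`. -/
noncomputable def zeta3 : ℝ := ∑' i : ℕ, ((i + 1 : ℝ) ^ 3)⁻¹

/-- The event `E_u`: there exists a four-cycle rooted at `u` in `G(c)` at least one of
whose four edges is long-range. -/
def badCycleEvent (n : ℕ) (u : Vx n) : Set (Vx n → Vx n) :=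
  {c | ∃ a b e : Vx n, a ≠ b ∧ a ≠ e ∧ b ≠ e ∧ a ≠ u ∧ b ≠ u ∧ e ≠ u ∧
    isEdge n c u a ∧ isEdge n c a b ∧ isEdge n c b e ∧ isEdge n c e u ∧
    (tdist n u a ≠ 1 ∨ tdist n a b ≠ 1 ∨ tdist n b e ≠ 1 ∨ tdist n e u ≠ 1)}

/-- Distance on the cycle of length `n`. -/
def cdist (n : ℕ) (a b : Fin n) : ℕ :=
  min ((a : ℤ) - (b : ℤ)).natAbs (n - ((a : ℤ) - (b : ℤ)).natAbs)

lemma tdist_eq_cdist_add (n : ℕ) (u v : Vx n) :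
    tdist n u v = cdist n u.1 v.1 + cdist n u.2 v.2 := rfl

lemma cdist_comm (n : ℕ) (a b : Fin n) : cdist n a b = cdist n b a := by
  unfold cdist; omega

lemma cdist_eq_zero (n : ℕ) (a b : Fin n) : cdist n a b = 0 ↔ a = b := by
  unfold cdist; rw [Fin.ext_iff]; omega

lemma two_mul_cdist_le (n : ℕ) (a b : Fin n) : 2 * cdist n a b ≤ n := by
  unfold cdist; omega

lemma tdist_comm (n : ℕ) (u v : Vx n) : tdist n u v = tdist n v u := by
  simp only [tdist_eq_cdist_add, cdist_comm n u.1, cdist_comm n u.2]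

lemma tdist_eq_zero (n : ℕ) (u v : Vx n) : tdist n u v = 0 ↔ u = v := by
  rw [tdist_eq_cdist_add, Nat.add_eq_zero_iff, cdist_eq_zero, cdist_eq_zero, Prod.ext_iff]

lemma tdist_le (n : ℕ) (u v : Vx n) : tdist n u v ≤ n := by
  have h1 := two_mul_cdist_le n u.1 v.1
  have h2 := two_mul_cdist_le n u.2 v.2
  rw [tdist_eq_cdist_add]; omega

/-- Two points of the cycle differ, modulo `n`, by an integer of absolute value `cdist`. -/
lemma exists_int_cdist (n : ℕ) (a b : Fin n) :
    ∃ s k : ℤ, (b : ℤ) - a = s + k * n ∧ s.natAbs = cdist n a b := by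
  unfold cdist
  rcases le_total (((a : ℤ) - (b : ℤ)).natAbs) (n - ((a : ℤ) - (b : ℤ)).natAbs) with h | h
  · exact ⟨b - a, 0, by ring, by omega⟩
  · rcases le_total (a : ℤ) b with h' | h'
    · exact ⟨b - a - n, 1, by ring, by omega⟩
    · exact ⟨b - a + n, -1, by ring, by omega⟩

lemma cdist_eq_natAbs {n : ℕ} {a b : Fin n} {s k : ℤ} (h : (b : ℤ) - a = s + k * n)
    (hs : 2 * s.natAbs < n) : cdist n a b = s.natAbs := by
  have h1 : k < 2 := by
    by_contra hk
    nlinarith [show (2 : ℤ) ≤ k by omega, show -(n : ℤ) < 2 * s by omega, a.2, b.2,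
      show (0 : ℤ) ≤ n by omega, show (b : ℤ) < n by omega, show (0 : ℤ) ≤ a by omega]
  have h2 : -2 < k := by
    by_contra hk
    nlinarith [show k ≤ (-2 : ℤ) by omega, show 2 * s < (n : ℤ) by omega,
      show (0 : ℤ) ≤ n by omega, show (a : ℤ) < n by omega, show (0 : ℤ) ≤ b by omega]
  unfold cdist
  obtain rfl | rfl | rfl : k = -1 ∨ k = 0 ∨ k = 1 := by omega
  all_goals omega

/-- A closed walk with three local steps and one further step of length other than one has that
step of length three, provided the torus is not too small. -/
lemma tdist_eq_three {n : ℕ} (hn : 7 ≤ n) {x y z w : Vx n} (h₁ : tdist n x y = 1)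
    (h₂ : tdist n y z = 1) (h₃ : tdist n z w = 1) (h₄ : tdist n x w ≠ 1) :
    tdist n x w = 3 := by
  rw [tdist_eq_cdist_add] at h₁ h₂ h₃ h₄ ⊢
  obtain ⟨s₁, k₁, e₁, a₁⟩ := exists_int_cdist n x.1 y.1
  obtain ⟨s₂, k₂, e₂, a₂⟩ := exists_int_cdist n y.1 z.1
  obtain ⟨s₃, k₃, e₃, a₃⟩ := exists_int_cdist n z.1 w.1
  obtain ⟨t₁, l₁, f₁, b₁⟩ := exists_int_cdist n x.2 y.2
  obtain ⟨t₂, l₂, f₂, b₂⟩ := exists_int_cdist n y.2 z.2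
  obtain ⟨t₃, l₃, f₃, b₃⟩ := exists_int_cdist n z.2 w.2
  rw [← a₁, ← b₁] at h₁
  rw [← a₂, ← b₂] at h₂
  rw [← a₃, ← b₃] at h₃
  clear a₁ a₂ a₃ b₁ b₂ b₃
  have p₁ : (s₁ + t₁) % 2 = 1 := by omega
  have p₂ : (s₂ + t₂) % 2 = 1 := by omega
  have p₃ : (s₃ + t₃) % 2 = 1 := by omega
  have hle : (s₁ + s₂ + s₃).natAbs + (t₁ + t₂ + t₃).natAbs ≤ 3 := by
    have := Int.natAbs_add_le (s₁ + s₂) s₃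
    have := Int.natAbs_add_le s₁ s₂
    have := Int.natAbs_add_le (t₁ + t₂) t₃
    have := Int.natAbs_add_le t₁ t₂
    linarith
  have hs : cdist n x.1 w.1 = (s₁ + s₂ + s₃).natAbs :=
    cdist_eq_natAbs (k := k₁ + k₂ + k₃) (by linear_combination e₁ + e₂ + e₃)
      (by lia)
  have ht : cdist n x.2 w.2 = (t₁ + t₂ + t₃).natAbs :=
    cdist_eq_natAbs (k := l₁ + l₂ + l₃) (by linear_combination f₁ + f₂ + f₃)
      (by lia)
  rw [hs, ht] at h₄ ⊢
  have hp : (s₁ + s₂ + s₃ + (t₁ + t₂ + t₃)) % 2 = 1 := by omega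
  clear hs ht p₁ p₂ p₃ h₁ h₂ h₃ e₁ e₂ e₃ f₁ f₂ f₃
  generalize s₁ + s₂ + s₃ = S at *
  generalize t₁ + t₂ + t₃ = T at *
  omega

/-- The number of points at distance `k` from a given point of the cycle of length `n`. -/
def cycleCount (n k : ℕ) : ℕ :=
  if k = 0 then 1 else if 2 * k < n then 2 else if 2 * k = n then 1 else 0

lemma card_cdist_eq {n : ℕ} (a : Fin n) (k : ℕ) :
    #(univ.filter fun b : Fin n => cdist n a b = k) = cycleCount n k := by
  have ha := a.2
  unfold cycleCount
  split_ifs with h0 h1 h2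
  · rw [Finset.card_eq_one]
    refine ⟨a, ?_⟩
    ext b
    simp [h0, cdist_eq_zero, eq_comm]
  · rw [Finset.card_eq_two]
    refine ⟨⟨if a + k < n then a + k else a + k - n, by split_ifs <;> omega⟩,
      ⟨if k ≤ a then a - k else a + n - k, by split_ifs <;> omega⟩, ?_, ?_⟩
    · rw [Ne, Fin.ext_iff]; dsimp only; split_ifs <;> omega
    · ext b
      have hb := b.2
      rw [Finset.mem_filter]
      simp only [mem_univ, true_and, mem_insert, mem_singleton, Fin.ext_iff, cdist]
      split_ifs <;> omega
  · rw [Finset.card_eq_one]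
    refine ⟨⟨if a + k < n then a + k else a + k - n, by split_ifs <;> omega⟩, ?_⟩
    ext b
    have hb := b.2
    rw [Finset.mem_filter]
    simp only [mem_univ, true_and, mem_singleton, Fin.ext_iff, cdist]
    split_ifs <;> omega
  · rw [Finset.card_eq_zero, Finset.filter_eq_empty_iff]
    intro b _ hb
    have := two_mul_cdist_le n a b
    omega

/-- The number of points at distance `d` from a given point of the `n × n` torus. -/
def sphereCount (n d : ℕ) : ℕ :=
  ∑ p ∈ antidiagonal d, cycleCount n p.1 * cycleCount n p.2

lemma card_tdist_eq {n : ℕ} (u : Vx n) (d : ℕ) :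
    #(univ.filter fun v : Vx n => tdist n u v = d) = sphereCount n d := by
  have : (univ.filter fun v : Vx n => tdist n u v = d) = (antidiagonal d).biUnion fun p =>
      (univ.filter fun b : Fin n => cdist n u.1 b = p.1) ×ˢ (univ.filter fun b : Fin n => cdist n u.2 b = p.2) := by
    ext v
    rw [Finset.mem_filter, tdist_eq_cdist_add]
    simp
  rw [this, Finset.card_biUnion]
  · simp [sphereCount, Finset.card_product, card_cdist_eq]
  · intro p _ q _ hpq
    rw [Function.onFun, Finset.disjoint_left]
    intro v hv hv'
    simp only [mem_product, mem_filter, mem_univ, true_and] at hv hv'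
    exact hpq (Prod.ext (hv.1.symm.trans hv'.1) (hv.2.symm.trans hv'.2))

lemma sum_antidiagonal_one_or_two {d : ℕ} (hd : 1 ≤ d) :
    ∑ p ∈ antidiagonal d, (if p.1 = 0 then 1 else 2) * (if p.2 = 0 then 1 else 2) = 4 * d := by
  obtain ⟨m, rfl⟩ : ∃ m, d = m + 1 := ⟨d - 1, by omega⟩
  rw [Finset.Nat.sum_antidiagonal_eq_sum_range_succ
    (fun i j : ℕ => (if i = 0 then 1 else 2) * (if j = 0 then 1 else 2)),
    Finset.sum_range_succ, Finset.sum_range_succ']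
  rw [Finset.sum_congr rfl (g := fun _ => 4)]
  · simp; ring
  · intro i hi
    rw [mem_range] at hi
    rw [if_neg (by omega), if_neg (by omega)]

lemma sphereCount_le (n : ℕ) {d : ℕ} (hd : 1 ≤ d) : sphereCount n d ≤ 4 * d := by
  have h (k : ℕ) : cycleCount n k ≤ if k = 0 then 1 else 2 := by
    unfold cycleCount; split_ifs <;> omega
  rw [← sum_antidiagonal_one_or_two hd]
  exact Finset.sum_le_sum fun p _ => Nat.mul_le_mul (h _) (h _)

lemma sphereCount_eq {n d : ℕ} (hd : 1 ≤ d) (hn : 2 * d < n) : sphereCount n d = 4 * d := by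
  rw [← sum_antidiagonal_one_or_two hd]
  refine Finset.sum_congr rfl fun p hp => ?_
  rw [Finset.HasAntidiagonal.mem_antidiagonal] at hp
  unfold cycleCount
  rw [if_pos (show 2 * p.1 < n by omega), if_pos (show 2 * p.2 < n by omega)]

/-- Sums of radial functions over the torus. -/
lemma sum_radial {n : ℕ} (u : Vx n) (φ : ℕ → ℝ) :
    ∑ v, φ (tdist n u v) = ∑ d ∈ range (n + 1), sphereCount n d * φ d := by
  rw [← Finset.sum_fiberwise_of_maps_to (s := univ) (t := range (n + 1)) (g := tdist n u)
    (fun v _ => mem_range.2 (Nat.lt_succ_of_le (tdist_le n u v)))]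
  refine Finset.sum_congr rfl fun d _ => ?_
  rw [Finset.sum_congr rfl (g := fun _ => φ d), Finset.sum_const, card_tdist_eq, nsmul_eq_mul]
  intro v hv
  rw [(mem_filter.1 hv).2]

/-- The common value of the normalizing factors. -/
noncomputable def normFactor (n : ℕ) : ℝ :=
  (∑ d ∈ range (n + 1), sphereCount n d * ((d : ℝ) ^ 2)⁻¹)⁻¹

lemma sum_inv_sq_tdist {n : ℕ} (u : Vx n) :
    ∑ v, ((tdist n u v : ℝ) ^ 2)⁻¹ = (normFactor n)⁻¹ := by
  rw [normFactor, inv_inv, ← sum_radial u fun d => ((d : ℝ) ^ 2)⁻¹]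

lemma Zfac_eq_normFactor {n : ℕ} (u : Vx n) : Zfac n u = normFactor n := by
  rw [← inv_inv (normFactor n), ← sum_inv_sq_tdist u, Zfac]
  congr 1
  refine Finset.sum_subset (Finset.filter_subset _ _) fun v _ hv => ?_
  have : u = v := by simpa [eq_comm] using hv
  simp [(tdist_eq_zero n u v).2 this]

lemma four_mul_log_le {n : ℕ} (hn : 1 ≤ n) :
    4 * Real.log ((n : ℝ) / 2) ≤ (normFactor n)⁻¹ := by
  set m := (n - 1) / 2 with hm
  have hlog : Real.log ((n : ℝ) / 2) ≤ Real.log ((m + 1 : ℕ) : ℝ) := by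
    apply Real.log_le_log (by positivity)
    have : n ≤ 2 * (m + 1) := by omega
    rw [div_le_iff₀ two_pos]
    exact_mod_cast (by omega : n ≤ (m + 1) * 2)
  have hharm := log_add_one_le_harmonic m
  rw [harmonic] at hharm
  push_cast at hharm hlog
  rw [normFactor, inv_inv, Finset.sum_range_succ']
  have hsum : 4 * ∑ i ∈ range m, ((i : ℝ) + 1)⁻¹ =
      ∑ i ∈ range m, sphereCount n (i + 1) * (((i + 1 : ℕ) : ℝ) ^ 2)⁻¹ := by
    rw [Finset.mul_sum]
    refine Finset.sum_congr rfl fun i hi => ?_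
    rw [mem_range] at hi
    rw [sphereCount_eq (by omega) (by omega)]
    push_cast
    field_simp
  have hsub : ∑ i ∈ range m, (sphereCount n (i + 1) : ℝ) * (((i + 1 : ℕ) : ℝ) ^ 2)⁻¹ ≤
      ∑ i ∈ range n, sphereCount n (i + 1) * (((i + 1 : ℕ) : ℝ) ^ 2)⁻¹ :=
    Finset.sum_le_sum_of_subset_of_nonneg (Finset.range_subset_range.2 (by omega))
      fun i _ _ => by positivity
  have h0 : (0 : ℝ) ≤ sphereCount n 0 * (((0 : ℕ) : ℝ) ^ 2)⁻¹ := by positivity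
  linarith

lemma normFactor_pos {n : ℕ} (hn : 3 ≤ n) : 0 < normFactor n := by
  have h := four_mul_log_le (n := n) (by omega)
  have hn' : (3 : ℝ) ≤ n := by exact_mod_cast hn
  have : 0 < Real.log ((n : ℝ) / 2) := Real.log_pos (by linarith)
  exact inv_pos.1 (by linarith)

/-- The inverse square of the distance, restricted to pairs at distance at least two. -/
noncomputable def farWeight (n : ℕ) (u v : Vx n) : ℝ :=
  if tdist n u v ≤ 1 then 0 else ((tdist n u v : ℝ) ^ 2)⁻¹

lemma farWeight_nonneg (n : ℕ) (u v : Vx n) : 0 ≤ farWeight n u v := by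
  unfold farWeight; split_ifs <;> positivity

lemma farWeight_comm (n : ℕ) (u v : Vx n) : farWeight n u v = farWeight n v u := by
  unfold farWeight; rw [tdist_comm]

lemma sum_inv_cube_le (N : ℕ) :
    ∑ d ∈ range (N + 2), 4 * (d : ℝ) * (if d ≤ 1 then (0 : ℝ) else ((d : ℝ) ^ 2)⁻¹) ^ 2 ≤
      1 - 2 / (((N : ℝ) + 1) * (N + 2)) := by
  induction N with
  | zero => simp [Finset.sum_range_succ]
  | succ k ih =>
    rw [Finset.sum_range_succ]
    have h : 4 * ((k + 2 : ℕ) : ℝ) * (if k + 2 ≤ 1 then 0 else (((k + 2 : ℕ) : ℝ) ^ 2)⁻¹) ^ 2 ≤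
        2 / (((k : ℝ) + 1) * (k + 2)) - 2 / (((k : ℝ) + 2) * (k + 3)) := by
      rw [if_neg (by omega)]
      push_cast
      have : 2 / (((k : ℝ) + 1) * (k + 2)) - 2 / (((k : ℝ) + 2) * (k + 3)) =
        4 / (((k : ℝ) + 1) * (k + 2) * (k + 3)) := by field_simp; ring
      rw [this]
      have : 4 * ((k : ℝ) + 2) * ((((k : ℝ) + 2) ^ 2)⁻¹) ^ 2 = 4 / ((k : ℝ) + 2) ^ 3 := by
        field_simp
      rw [this]
      apply div_le_div_of_nonneg_left (by norm_num) (by positivity)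
      nlinarith [show (0 : ℝ) ≤ k by positivity]
    have e : (((k + 1 : ℕ) : ℝ) + 1) * (((k + 1 : ℕ) : ℝ) + 2) = ((k : ℝ) + 2) * (k + 3) := by
      push_cast; ring
    rw [e]
    linarith

lemma sum_farWeight_sq_le {n : ℕ} (hn : 1 ≤ n) (u : Vx n) : ∑ v, farWeight n u v ^ 2 ≤ 1 := by
  have h := sum_radial u fun d => (if d ≤ 1 then (0 : ℝ) else ((d : ℝ) ^ 2)⁻¹) ^ 2
  simp only [farWeight]
  rw [h]
  obtain ⟨N, rfl⟩ : ∃ N, n = N + 1 := ⟨n - 1, by omega⟩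
  calc _ ≤ ∑ d ∈ range (N + 2), 4 * (d : ℝ) *
        (if d ≤ 1 then (0 : ℝ) else ((d : ℝ) ^ 2)⁻¹) ^ 2 := by
        refine Finset.sum_le_sum fun d _ => ?_
        rcases Nat.eq_zero_or_pos d with rfl | hd
        · simp
        · gcongr
          exact_mod_cast sphereCount_le (N + 1) hd
    _ ≤ 1 - 2 / (((N : ℝ) + 1) * (N + 2)) := sum_inv_cube_le N
    _ ≤ 1 := sub_le_self _ (by positivity)

lemma sum_farWeight_le {n : ℕ} (u : Vx n) : ∑ v, farWeight n u v ≤ (normFactor n)⁻¹ := by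
  rw [← sum_inv_sq_tdist u]
  refine Finset.sum_le_sum fun v _ => ?_
  unfold farWeight; split_ifs
  · positivity
  · exact le_rfl

/-- Indicator of local pairs. -/
noncomputable def nearWeight (n : ℕ) (u v : Vx n) : ℝ := if tdist n u v = 1 then 1 else 0

lemma nearWeight_nonneg (n : ℕ) (u v : Vx n) : 0 ≤ nearWeight n u v := by
  unfold nearWeight; split_ifs <;> positivity

lemma nearWeight_comm (n : ℕ) (u v : Vx n) : nearWeight n u v = nearWeight n v u := by
  unfold nearWeight; rw [tdist_comm]

lemma sum_nearWeight_le {n : ℕ} (u : Vx n) : ∑ v, nearWeight n u v ≤ 4 := by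
  unfold nearWeight
  rw [Finset.sum_boole, card_tdist_eq]
  exact_mod_cast sphereCount_le n le_rfl

/-- Upper bound for the probability that `{u, v}` is an edge. -/
noncomputable def edgeWeight (n : ℕ) (u v : Vx n) : ℝ :=
  nearWeight n u v + 2 * normFactor n * farWeight n u v

lemma edgeWeight_nonneg {n : ℕ} (hn : 3 ≤ n) (u v : Vx n) : 0 ≤ edgeWeight n u v := by
  have := normFactor_pos hn
  have := nearWeight_nonneg n u v
  have := farWeight_nonneg n u v
  unfold edgeWeight; positivity

lemma edgeWeight_comm (n : ℕ) (u v : Vx n) : edgeWeight n u v = edgeWeight n v u := by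
  unfold edgeWeight; rw [nearWeight_comm, farWeight_comm]

lemma sum_edgeWeight_le {n : ℕ} (hn : 3 ≤ n) (u : Vx n) : ∑ v, edgeWeight n u v ≤ 6 := by
  have hz := normFactor_pos hn
  have h := mul_le_mul_of_nonneg_left (sum_farWeight_le u) hz.le
  rw [mul_inv_cancel₀ hz.ne'] at h
  simp only [edgeWeight]
  rw [Finset.sum_add_distrib, ← Finset.mul_sum]
  linarith [sum_nearWeight_le u]

/-- The probability that the long-range contact of `u` is `v`. -/
noncomputable def linkProb (n : ℕ) (u v : Vx n) : ℝ :=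
  normFactor n * ((tdist n u v : ℝ) ^ 2)⁻¹

lemma linkProb_nonneg {n : ℕ} (hn : 3 ≤ n) (u v : Vx n) : 0 ≤ linkProb n u v := by
  have := normFactor_pos hn
  unfold linkProb; positivity

lemma linkProb_comm (n : ℕ) (u v : Vx n) : linkProb n u v = linkProb n v u := by
  unfold linkProb; rw [tdist_comm]

lemma sum_linkProb {n : ℕ} (hn : 3 ≤ n) (u : Vx n) : ∑ v, linkProb n u v = 1 := by
  simp only [linkProb]
  rw [← Finset.mul_sum, sum_inv_sq_tdist, mul_inv_cancel₀ (normFactor_pos hn).ne']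

lemma mass_eq (n : ℕ) (c : Vx n → Vx n) : mass n c = ∏ u, linkProb n u (c u) := by
  refine Finset.prod_congr rfl fun u _ => ?_
  rw [linkProb, ← Zfac_eq_normFactor u]
  split_ifs with h
  · rw [(tdist_eq_zero n u (c u)).2 h.symm]; simp
  · rfl

lemma mass_nonneg {n : ℕ} (hn : 3 ≤ n) (c : Vx n → Vx n) : 0 ≤ mass n c := by
  rw [mass_eq]; exact Finset.prod_nonneg fun u _ => linkProb_nonneg hn _ _

lemma Pr_mono {n : ℕ} (hn : 3 ≤ n) {E F : Set (Vx n → Vx n)} (h : E ⊆ F) : Pr n E ≤ Pr n F := by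
  refine Finset.sum_le_sum fun c _ => ?_
  by_cases hE : c ∈ E
  · rw [if_pos hE, if_pos (h hE)]
  · rw [if_neg hE]; split_ifs
    · exact mass_nonneg hn c
    · exact le_rfl

lemma Pr_union_le {n : ℕ} (hn : 3 ≤ n) (E F : Set (Vx n → Vx n)) :
    Pr n (E ∪ F) ≤ Pr n E + Pr n F := by
  unfold Pr
  rw [← Finset.sum_add_distrib]
  refine Finset.sum_le_sum fun c _ => ?_
  have := mass_nonneg hn c
  by_cases hE : c ∈ E <;> by_cases hF : c ∈ F <;> simp [hE, hF, this]

/-- Independence of the choices, for events prescribing sets of possible contacts. -/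
lemma Pr_pi (n : ℕ) (t : Vx n → Finset (Vx n)) :
    Pr n {c | ∀ u, c u ∈ t u} = ∏ u, ∑ v ∈ t u, linkProb n u v := by
  rw [Finset.prod_univ_sum, ← Finset.univ_inter (Fintype.piFinset t), ← Finset.sum_ite_mem, Pr]
  refine Finset.sum_congr rfl fun c _ => ?_
  simp only [Set.mem_ofPred_eq, Fintype.mem_piFinset, mass_eq]

lemma Pr_univ {n : ℕ} (hn : 3 ≤ n) : Pr n Set.univ = 1 := by
  have := Pr_pi n fun _ => univ
  simpa [sum_linkProb hn] using this

lemma Pr_le_one {n : ℕ} (hn : 3 ≤ n) (E : Set (Vx n → Vx n)) : Pr n E ≤ 1 :=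
  (Pr_mono hn (Set.subset_univ E)).trans_eq (Pr_univ hn)

/-- Prescribed contacts along distinct ordered pairs have probability at most the product. -/
lemma Pr_forall_link_le {n : ℕ} (hn : 3 ≤ n) (P : Finset (Vx n × Vx n)) :
    Pr n {c | ∀ p ∈ P, c p.1 = p.2} ≤ ∏ p ∈ P, linkProb n p.1 p.2 := by
  have h := Pr_pi n fun u => univ.filter fun v => ∀ p ∈ P, p.1 = u → v = p.2
  have hset : {c : Vx n → Vx n | ∀ p ∈ P, c p.1 = p.2} =
      {c | ∀ u, c u ∈ univ.filter fun v => ∀ p ∈ P, p.1 = u → v = p.2} := by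
    ext c
    simp only [Set.mem_ofPred_eq, mem_filter, mem_univ, true_and]
    exact ⟨fun H u p hp hu => hu ▸ H p hp, fun H p hp => H p.1 p hp rfl⟩
  rw [hset, h, ← Finset.prod_fiberwise P Prod.fst]
  refine Finset.prod_le_prod
    (fun u _ => Finset.sum_nonneg fun v _ => linkProb_nonneg hn _ _) fun u _ => ?_
  have hnn : 0 ≤ ∏ p ∈ P.filter (fun p => p.1 = u), linkProb n p.1 p.2 :=
    Finset.prod_nonneg fun p _ => linkProb_nonneg hn _ _
  rcases (P.filter fun p => p.1 = u).eq_empty_or_nonempty with he | ⟨q, hq⟩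
  · rw [he, Finset.prod_empty, ← sum_linkProb hn u]
    exact Finset.sum_le_univ_sum_of_nonneg fun v => linkProb_nonneg hn _ _
  · obtain ⟨hqP, rfl⟩ := mem_filter.1 hq
    by_cases hone : ∀ p ∈ P, p.1 = q.1 → p.2 = q.2
    · have e1 : P.filter (fun p => p.1 = q.1) = {q} := by
        ext p
        rw [mem_filter, mem_singleton]
        exact ⟨fun ⟨hp, hpq⟩ => Prod.ext hpq (hone p hp hpq), by rintro rfl; exact ⟨hqP, rfl⟩⟩
      rw [e1, Finset.prod_singleton, ← Finset.sum_singleton (fun v => linkProb n q.1 v) q.2]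
      refine Finset.sum_le_sum_of_subset_of_nonneg (fun v hv => ?_)
        fun v _ _ => linkProb_nonneg hn _ _
      exact mem_singleton.2 ((mem_filter.1 hv).2 q hqP rfl)
    · push Not at hone
      obtain ⟨p, hp, h1, h2⟩ := hone
      refine le_of_eq_of_le (Finset.sum_eq_zero fun v hv => ?_) hnn
      have hv := (mem_filter.1 hv).2
      exact absurd ((hv p hp h1).symm.trans (hv q hqP rfl)) h2

lemma edgeWeight_eq_two_mul_linkProb {n : ℕ} {u v : Vx n} (huv : u ≠ v) (h : tdist n u v ≠ 1) :
    edgeWeight n u v = 2 * linkProb n u v := by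
  have h0 : tdist n u v ≠ 0 := fun h0 => huv ((tdist_eq_zero n u v).1 h0)
  rw [edgeWeight, nearWeight, farWeight, linkProb, if_neg h, if_neg (by omega)]
  ring

/-- Distinct edges are simultaneously present with probability at most the product of the edge
weights, even jointly with prescribed contacts along further pairs. -/
lemma Pr_link_and_edges_le {n : ℕ} (hn : 3 ≤ n) (l : List (Vx n × Vx n)) :
    ∀ P : Finset (Vx n × Vx n),
      (l.map fun p => s(p.1, p.2)).Nodup →
      (∀ p ∈ l, p ∉ P ∧ p.swap ∉ P) →
      Pr n {c | (∀ p ∈ P, c p.1 = p.2) ∧ ∀ p ∈ l, isEdge n c p.1 p.2} ≤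
        (∏ p ∈ P, linkProb n p.1 p.2) * (l.map fun p => edgeWeight n p.1 p.2).prod := by
  induction l with
  | nil => intro P _ _; simpa using Pr_forall_link_le hn P
  | cons q l ih =>
    intro P hnd hP
    rw [List.map_cons, List.nodup_cons] at hnd
    obtain ⟨hq, hnd⟩ := hnd
    have hP' : ∀ p ∈ l, p ∉ P ∧ p.swap ∉ P := fun p hp => hP p (List.mem_cons_of_mem _ hp)
    have hne : ∀ p ∈ l, p ≠ q ∧ p ≠ q.swap := by
      intro p hp
      constructor <;> rintro rfl <;> refine hq (List.mem_map.2 ⟨_, hp, ?_⟩)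
      · rfl
      · exact Sym2.eq_swap
    have hRnn : 0 ≤ (∏ p ∈ P, linkProb n p.1 p.2) *
        ((q :: l).map fun p => edgeWeight n p.1 p.2).prod :=
      mul_nonneg (Finset.prod_nonneg fun p _ => linkProb_nonneg hn _ _)
        (List.prod_nonneg (by simp only [List.mem_map]; rintro _ ⟨p, _, rfl⟩
                              exact edgeWeight_nonneg hn _ _))
    by_cases hqq : q.1 = q.2
    · refine le_of_eq_of_le (Finset.sum_eq_zero fun c _ => if_neg ?_) hRnn
      exact fun hc => (hc.2 q List.mem_cons_self).1 hqq
    by_cases hloc : tdist n q.1 q.2 = 1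
    · refine (Pr_mono hn ?_).trans ((ih P hnd hP').trans_eq ?_)
      · exact fun c hc => ⟨hc.1, fun p hp => hc.2 p (List.mem_cons_of_mem _ hp)⟩
      · rw [List.map_cons, List.prod_cons, edgeWeight, nearWeight, farWeight, if_pos hloc,
          if_pos hloc.le]
        ring
    · have key (r : Vx n × Vx n) (hr : r = q ∨ r = q.swap) :
          Pr n {c | (∀ p ∈ insert r P, c p.1 = p.2) ∧ ∀ p ∈ l, isEdge n c p.1 p.2} ≤
          linkProb n q.1 q.2 * (∏ p ∈ P, linkProb n p.1 p.2) *
            (l.map fun p => edgeWeight n p.1 p.2).prod := by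
        have hqP := hP q List.mem_cons_self
        have hrP : r ∉ P := by rcases hr with rfl | rfl; exacts [hqP.1, hqP.2]
        have hrq : linkProb n r.1 r.2 = linkProb n q.1 q.2 := by
          rcases hr with rfl | rfl
          · rfl
          · exact linkProb_comm n _ _
        refine (ih (insert r P) hnd fun p hp => ?_).trans_eq ?_
        · have h1 := hne p hp
          have h2 : p.swap ≠ q ∧ p.swap ≠ q.swap :=
            ⟨fun h => h1.2 (by rw [← h, Prod.swap_swap]), fun h => h1.1 (Prod.swap_injective h)⟩
          simp only [Finset.mem_insert, not_or]
          rcases hr with rfl | rfl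
          · exact ⟨⟨h1.1, (hP' p hp).1⟩, h2.1, (hP' p hp).2⟩
          · exact ⟨⟨h1.2, (hP' p hp).1⟩, h2.2, (hP' p hp).2⟩
        · rw [Finset.prod_insert hrP, hrq]
      refine (Pr_mono hn ?_).trans ((Pr_union_le hn _ _).trans
        ((add_le_add (key q (Or.inl rfl)) (key q.swap (Or.inr rfl))).trans_eq ?_))
      · rintro c ⟨hc, hl⟩
        have hl' : ∀ p ∈ l, isEdge n c p.1 p.2 := fun p hp => hl p (List.mem_cons_of_mem _ hp)
        rcases (hl q List.mem_cons_self).2 with h | h | h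
        · exact absurd h hloc
        · left
          refine ⟨fun p hp => ?_, hl'⟩
          rcases Finset.mem_insert.1 hp with rfl | hp
          exacts [h, hc p hp]
        · right
          refine ⟨fun p hp => ?_, hl'⟩
          rcases Finset.mem_insert.1 hp with rfl | hp
          exacts [h, hc p hp]
      · rw [List.map_cons, List.prod_cons, edgeWeight_eq_two_mul_linkProb hqq hloc]
        ring

/-- The vertices `u, a, b, e` form, in this order, a four-cycle of `G(c)`. -/
def IsFourCycle (n : ℕ) (c : Vx n → Vx n) (u a b e : Vx n) : Prop :=
  isEdge n c u a ∧ isEdge n c a b ∧ isEdge n c b e ∧ isEdge n c e u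

lemma Pr_isFourCycle_le {n : ℕ} (hn : 3 ≤ n) {u a b e : Vx n} (hub : u ≠ b) (hae : a ≠ e) :
    Pr n {c | IsFourCycle n c u a b e} ≤
      edgeWeight n u a * edgeWeight n a b * edgeWeight n b e * edgeWeight n e u := by
  by_cases h : u ≠ a ∧ a ≠ b ∧ b ≠ e ∧ e ≠ u
  · have := Pr_link_and_edges_le hn [(u, a), (a, b), (b, e), (e, u)] ∅ (by
      obtain ⟨h1, h2, h3, h4⟩ := h
      simp [hub, hae, h1, h2, h3, h4, hub.symm, h1.symm, h4.symm])
      (by simp)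
    simpa [IsFourCycle, mul_assoc] using this
  · refine le_of_eq_of_le (Finset.sum_eq_zero fun c _ => if_neg fun hc => h ?_) ?_
    · exact ⟨hc.1.1, hc.2.1.1, hc.2.2.1.1, hc.2.2.2.1⟩
    · have := edgeWeight_nonneg hn u a
      have := edgeWeight_nonneg hn a b
      have := edgeWeight_nonneg hn b e
      have := edgeWeight_nonneg hn e u
      positivity

/-- The vertices `u, a, b, e` satisfy the conditions on a rooted four-cycle with a long-range
edge that do not depend on the random choices. -/
def IsBadQuadruple (n : ℕ) (u a b e : Vx n) : Prop :=
  u ≠ b ∧ a ≠ e ∧ ¬(tdist n u a = 1 ∧ tdist n a b = 1 ∧ tdist n b e = 1 ∧ tdist n e u = 1)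

lemma isEdge_comm {n : ℕ} {c : Vx n → Vx n} {x y : Vx n} (h : isEdge n c x y) :
    isEdge n c y x :=
  ⟨h.1.symm, by rw [tdist_comm]; exact h.2.imp id Or.symm⟩

lemma IsFourCycle.reverse {n : ℕ} {c : Vx n → Vx n} {u a b e : Vx n}
    (h : IsFourCycle n c u a b e) : IsFourCycle n c u e b a :=
  ⟨isEdge_comm h.2.2.2, isEdge_comm h.2.2.1, isEdge_comm h.2.1, isEdge_comm h.1⟩

lemma IsBadQuadruple.reverse {n : ℕ} {u a b e : Vx n}
    (h : IsBadQuadruple n u a b e) : IsBadQuadruple n u e b a := by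
  refine ⟨h.1, h.2.1.symm, fun h' => h.2.2 ?_⟩
  rw [tdist_comm n u a, tdist_comm n a b, tdist_comm n b e, tdist_comm n e u]
  exact ⟨h'.2.2.2, h'.2.2.1, h'.2.1, h'.1⟩

/-- Union bound, using that every cycle is counted once for each of its two orientations. -/
lemma two_mul_Pr_badCycleEvent_le {n : ℕ} (hn : 3 ≤ n) (u : Vx n) :
    2 * Pr n (badCycleEvent n u) ≤ ∑ a, ∑ b, ∑ e, if IsBadQuadruple n u a b e then
      edgeWeight n u a * edgeWeight n a b * edgeWeight n b e * edgeWeight n e u else 0 := by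
  have hpoint (c : Vx n → Vx n) : 2 * (if c ∈ badCycleEvent n u then mass n c else 0) ≤
      ∑ t : Vx n × Vx n × Vx n,
        if IsBadQuadruple n u t.1 t.2.1 t.2.2 ∧ IsFourCycle n c u t.1 t.2.1 t.2.2
          then mass n c else 0 := by
    have hnn (t : Vx n × Vx n × Vx n) :
        0 ≤ if IsBadQuadruple n u t.1 t.2.1 t.2.2 ∧ IsFourCycle n c u t.1 t.2.1 t.2.2
          then mass n c else 0 := by
      split_ifs
      · exact mass_nonneg hn c
      · exact le_rfl
    by_cases hc : c ∈ badCycleEvent n u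
    · rw [if_pos hc]
      obtain ⟨a, b, e, -, hae, -, -, hbu, -, h1, h2, h3, h4, hlong⟩ := hc
      have hcyc : IsFourCycle n c u a b e := ⟨h1, h2, h3, h4⟩
      have hbad : IsBadQuadruple n u a b e := ⟨hbu.symm, hae, by tauto⟩
      have hne : (a, b, e) ≠ (e, b, a) := fun h => hae (congrArg Prod.fst h)
      refine le_trans (le_of_eq ?_) (Finset.sum_le_univ_sum_of_nonneg hnn
        (s := {(a, b, e), (e, b, a)}))
      rw [Finset.sum_pair hne, if_pos ⟨hbad, hcyc⟩, if_pos ⟨hbad.reverse, hcyc.reverse⟩, two_mul]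
    · rw [if_neg hc, mul_zero]
      exact Finset.sum_nonneg fun t _ => hnn t
  rw [Pr, Finset.mul_sum]
  refine (Finset.sum_le_sum fun c _ => hpoint c).trans ?_
  rw [Finset.sum_comm, Fintype.sum_prod_type]
  refine Finset.sum_le_sum fun a _ => ?_
  rw [Fintype.sum_prod_type]
  refine Finset.sum_le_sum fun b _ => Finset.sum_le_sum fun e _ => ?_
  by_cases hbad : IsBadQuadruple n u a b e
  · simp only [hbad, true_and, if_true]
    exact Pr_isFourCycle_le hn hbad.1 hbad.2.1
  · simp [hbad]

/-- A nonnegative symmetric kernel with row sums at most `k`. -/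
structure IsBoundedKernel {V : Type*} [Fintype V] (K : V → V → ℝ) (k : ℝ) : Prop where
  nonneg : ∀ x y, 0 ≤ K x y
  comm : ∀ x y, K x y = K y x
  sum_le : ∀ x, ∑ y, K x y ≤ k

namespace IsBoundedKernel

variable {V : Type*} [Fintype V] {K K₁ K₂ K₃ : V → V → ℝ} {k k₁ k₂ k₃ : ℝ}

lemma bound_nonneg (h : IsBoundedKernel K k) (x : V) : 0 ≤ k :=
  (Finset.sum_nonneg fun y _ => h.nonneg x y).trans (h.sum_le x)

lemma sum_mul_le (h : IsBoundedKernel K k) {F : V → ℝ} {B : ℝ} (hB : 0 ≤ B)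
    (hF : ∀ y, F y ≤ B) (x : V) : ∑ y, K x y * F y ≤ k * B := by
  calc ∑ y, K x y * F y ≤ ∑ y, K x y * B :=
        Finset.sum_le_sum fun y _ => mul_le_mul_of_nonneg_left (hF y) (h.nonneg x y)
    _ = (∑ y, K x y) * B := (Finset.sum_mul _ _ _).symm
    _ ≤ k * B := mul_le_mul_of_nonneg_right (h.sum_le x) hB

lemma sum_chain_le (h₁ : IsBoundedKernel K₁ k₁) (h₂ : IsBoundedKernel K₂ k₂)
    (h₃ : IsBoundedKernel K₃ k₃) (u : V) :
    ∑ a, ∑ b, ∑ e, K₁ u a * K₂ a b * K₃ b e ≤ k₁ * k₂ * k₃ := by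
  have hk₂ := h₂.bound_nonneg u
  have hk₃ := h₃.bound_nonneg u
  rw [mul_assoc]
  simp only [mul_assoc, ← Finset.mul_sum]
  exact h₁.sum_mul_le (by positivity) (fun a => h₂.sum_mul_le hk₃ (fun b => h₃.sum_le b) a) u

lemma sum_fork_le (h₁ : IsBoundedKernel K₁ k₁) (h₂ : IsBoundedKernel K₂ k₂)
    (h₃ : IsBoundedKernel K₃ k₃) (u : V) :
    ∑ a, ∑ b, ∑ e, K₁ a u * K₂ u e * K₃ e b ≤ k₁ * k₂ * k₃ := by
  have hk₂ := h₂.bound_nonneg u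
  have hk₃ := h₃.bound_nonneg u
  have hswap (a : V) : ∑ b, ∑ e, K₁ a u * K₂ u e * K₃ e b =
      K₁ u a * ∑ e, K₂ u e * ∑ b, K₃ e b := by
    rw [Finset.sum_comm, h₁.comm a u]
    simp only [mul_assoc, ← Finset.mul_sum]
  simp only [hswap]
  rw [mul_assoc]
  exact h₁.sum_mul_le (by positivity) (fun _ => h₂.sum_mul_le hk₃ (fun e => h₃.sum_le e) u) u

end IsBoundedKernel

lemma isBoundedKernel_nearWeight (n : ℕ) : IsBoundedKernel (nearWeight n) 4 :=
  ⟨nearWeight_nonneg n, nearWeight_comm n, sum_nearWeight_le⟩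

lemma isBoundedKernel_edgeWeight {n : ℕ} (hn : 3 ≤ n) : IsBoundedKernel (edgeWeight n) 6 :=
  ⟨edgeWeight_nonneg hn, edgeWeight_comm n, sum_edgeWeight_le hn⟩

lemma isBoundedKernel_farWeight_sq {n : ℕ} (hn : 3 ≤ n) :
    IsBoundedKernel (fun x y => farWeight n x y ^ 2) 1 :=
  ⟨fun _ _ => sq_nonneg _, fun x y => by rw [farWeight_comm],
    sum_farWeight_sq_le (by omega)⟩

/-- The contribution of a path with three edges, obtained from a four-cycle with a long-range
edge by deleting one long-range edge. -/
noncomputable def pathWeight (n : ℕ) (x y z w : Vx n) : ℝ :=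
  2 * normFactor n / 9 * (nearWeight n x y * nearWeight n y z * nearWeight n z w) +
  2 * normFactor n ^ 2 *
    (farWeight n x y ^ 2 * edgeWeight n y z * edgeWeight n z w +
     edgeWeight n x y * farWeight n y z ^ 2 * edgeWeight n z w +
     edgeWeight n x y * edgeWeight n y z * farWeight n z w ^ 2)

lemma sum_pathWeight_chain_le {n : ℕ} (hn : 3 ≤ n) (u : Vx n) :
    ∑ a, ∑ b, ∑ e, pathWeight n u a b e ≤
      128 / 9 * normFactor n + 216 * normFactor n ^ 2 := by
  have hz := normFactor_pos hn
  have N := isBoundedKernel_nearWeight n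
  have K := isBoundedKernel_edgeWeight hn
  have F := isBoundedKernel_farWeight_sq hn
  have h0 := mul_le_mul_of_nonneg_left (N.sum_chain_le N N u)
    (show 0 ≤ 2 * normFactor n / 9 by positivity)
  have h1 := mul_le_mul_of_nonneg_left
    (add_le_add (add_le_add (F.sum_chain_le K K u) (K.sum_chain_le F K u)) (K.sum_chain_le K F u))
    (show 0 ≤ 2 * normFactor n ^ 2 by positivity)
  simp only [pathWeight, Finset.sum_add_distrib, ← Finset.mul_sum] at h0 h1 ⊢
  linarith

lemma sum_pathWeight_fork_le {n : ℕ} (hn : 3 ≤ n) (u : Vx n) :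
    ∑ a, ∑ b, ∑ e, pathWeight n a u e b ≤
      128 / 9 * normFactor n + 216 * normFactor n ^ 2 := by
  have hz := normFactor_pos hn
  have N := isBoundedKernel_nearWeight n
  have K := isBoundedKernel_edgeWeight hn
  have F := isBoundedKernel_farWeight_sq hn
  have h0 := mul_le_mul_of_nonneg_left (N.sum_fork_le N N u)
    (show 0 ≤ 2 * normFactor n / 9 by positivity)
  have h1 := mul_le_mul_of_nonneg_left
    (add_le_add (add_le_add (F.sum_fork_le K K u) (K.sum_fork_le F K u)) (K.sum_fork_le K F u))
    (show 0 ≤ 2 * normFactor n ^ 2 by positivity)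
  simp only [pathWeight, Finset.sum_add_distrib, ← Finset.mul_sum]
  linarith

lemma sum_reverse {V : Type*} [Fintype V] (f : V → V → V → ℝ) :
    ∑ a, ∑ b, ∑ e, f e b a = ∑ a, ∑ b, ∑ e, f a b e := by
  rw [Finset.sum_comm]
  conv_rhs => rw [Finset.sum_comm]
  exact Finset.sum_congr rfl fun b _ => Finset.sum_comm

lemma pathWeight_nonneg {n : ℕ} (hn : 3 ≤ n) (x y z w : Vx n) : 0 ≤ pathWeight n x y z w := by
  have := normFactor_pos hn
  have := nearWeight_nonneg n x y
  have := nearWeight_nonneg n y z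
  have := nearWeight_nonneg n z w
  have := edgeWeight_nonneg hn x y
  have := edgeWeight_nonneg hn y z
  have := edgeWeight_nonneg hn z w
  unfold pathWeight; positivity

/-- If all edges of a four-cycle but one are local, then its weight is bounded by the path weight
of its local edges. -/
lemma edgeWeight_prod_le_pathWeight {n : ℕ} (hn : 7 ≤ n) {x y z w : Vx n}
    (h₁ : tdist n x y = 1) (h₂ : tdist n y z = 1) (h₃ : tdist n z w = 1) (h₄ : tdist n w x ≠ 1) :
    edgeWeight n x y * edgeWeight n y z * edgeWeight n z w * edgeWeight n w x ≤
      pathWeight n x y z w := by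
  rw [tdist_comm] at h₄
  have h := tdist_eq_three hn h₁ h₂ h₃ h₄
  rw [edgeWeight_comm n w x]
  simp only [pathWeight, edgeWeight, nearWeight, farWeight, h₁, h₂, h₃, h]
  norm_num
  linarith

lemma edgeWeight_eq_of_ne {n : ℕ} {x y : Vx n} (h : tdist n x y ≠ 1) :
    edgeWeight n x y = 2 * normFactor n * farWeight n x y := by
  rw [edgeWeight, nearWeight, if_neg h, zero_add]

lemma mul_mul_le_of_eq {Z g g' K K' R : ℝ} (hK : K = 2 * Z * g) (hK' : K' = 2 * Z * g')
    (hR : 0 ≤ R) : K * K' * R ≤ 2 * Z ^ 2 * (g ^ 2 * R) + 2 * Z ^ 2 * (g' ^ 2 * R) := by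
  subst hK hK'
  nlinarith [mul_nonneg (mul_nonneg (sq_nonneg Z) (sq_nonneg (g - g'))) hR]

/-- The algebraic inequality behind the case of two long-range edges. Here `pᵢ` says that the
`i`-th edge is local. -/
lemma four_cycle_bound_of_two {Z N₁ N₂ N₃ N₄ K₁ K₂ K₃ K₄ g₁ g₂ g₃ g₄ : ℝ} {p₁ p₂ p₃ p₄ : Prop}
    (hZ : 0 ≤ Z) (n₁ : 0 ≤ N₁) (n₂ : 0 ≤ N₂) (n₃ : 0 ≤ N₃) (n₄ : 0 ≤ N₄)
    (k₁ : 0 ≤ K₁) (k₂ : 0 ≤ K₂) (k₃ : 0 ≤ K₃) (k₄ : 0 ≤ K₄)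
    (e₁ : ¬p₁ → K₁ = 2 * Z * g₁) (e₂ : ¬p₂ → K₂ = 2 * Z * g₂)
    (e₃ : ¬p₃ → K₃ = 2 * Z * g₃) (e₄ : ¬p₄ → K₄ = 2 * Z * g₄)
    (hp : ¬((p₁ ∨ p₂) ∧ (p₁ ∨ p₃) ∧ (p₁ ∨ p₄) ∧ (p₂ ∨ p₃) ∧ (p₂ ∨ p₄) ∧ (p₃ ∨ p₄))) :
    K₁ * K₂ * K₃ * K₄ ≤
      2 * Z / 9 * (N₁ * N₂ * N₃) +
        2 * Z ^ 2 * (g₁ ^ 2 * K₂ * K₃ + K₁ * g₂ ^ 2 * K₃ + K₁ * K₂ * g₃ ^ 2) +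
      (2 * Z / 9 * (N₄ * N₃ * N₂) +
        2 * Z ^ 2 * (g₄ ^ 2 * K₃ * K₂ + K₄ * g₃ ^ 2 * K₂ + K₄ * K₃ * g₂ ^ 2)) +
      (2 * Z / 9 * (N₁ * N₄ * N₃) +
        2 * Z ^ 2 * (g₁ ^ 2 * K₄ * K₃ + K₁ * g₄ ^ 2 * K₃ + K₁ * K₄ * g₃ ^ 2)) +
      (2 * Z / 9 * (N₄ * N₁ * N₂) +
        2 * Z ^ 2 * (g₄ ^ 2 * K₁ * K₂ + K₄ * g₁ ^ 2 * K₂ + K₄ * K₁ * g₂ ^ 2)) := by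
  have t : 0 ≤ 2 * Z / 9 * (N₁ * N₂ * N₃ + N₄ * N₃ * N₂ + N₁ * N₄ * N₃ + N₄ * N₁ * N₂) := by
    positivity
  have s₁₂ : 0 ≤ Z ^ 2 * (g₁ ^ 2 * (K₃ * K₄)) := by positivity
  have s₁₃ : 0 ≤ Z ^ 2 * (g₁ ^ 2 * (K₂ * K₄)) := by positivity
  have s₁₄ : 0 ≤ Z ^ 2 * (g₁ ^ 2 * (K₂ * K₃)) := by positivity
  have s₂₁ : 0 ≤ Z ^ 2 * (g₂ ^ 2 * (K₃ * K₄)) := by positivity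
  have s₂₃ : 0 ≤ Z ^ 2 * (g₂ ^ 2 * (K₁ * K₄)) := by positivity
  have s₂₄ : 0 ≤ Z ^ 2 * (g₂ ^ 2 * (K₁ * K₃)) := by positivity
  have s₃₁ : 0 ≤ Z ^ 2 * (g₃ ^ 2 * (K₂ * K₄)) := by positivity
  have s₃₂ : 0 ≤ Z ^ 2 * (g₃ ^ 2 * (K₁ * K₄)) := by positivity
  have s₃₄ : 0 ≤ Z ^ 2 * (g₃ ^ 2 * (K₁ * K₂)) := by positivity
  have s₄₁ : 0 ≤ Z ^ 2 * (g₄ ^ 2 * (K₂ * K₃)) := by positivity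
  have s₄₂ : 0 ≤ Z ^ 2 * (g₄ ^ 2 * (K₁ * K₃)) := by positivity
  have s₄₃ : 0 ≤ Z ^ 2 * (g₄ ^ 2 * (K₁ * K₂)) := by positivity
  simp only [not_and_or, not_or] at hp
  rcases hp with ⟨x, y⟩ | ⟨x, y⟩ | ⟨x, y⟩ | ⟨x, y⟩ | ⟨x, y⟩ | ⟨x, y⟩
  · linear_combination mul_mul_le_of_eq (e₁ x) (e₂ y) (mul_nonneg k₃ k₄) + t +
      2 * (s₁₃ + s₁₄ + s₂₃ + s₂₄ + s₃₁ + s₃₂ + s₃₄ + s₄₁ + s₄₂ + s₄₃)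
  · linear_combination mul_mul_le_of_eq (e₁ x) (e₃ y) (mul_nonneg k₂ k₄) + t +
      2 * (s₁₂ + s₁₄ + s₂₁ + s₂₃ + s₂₄ + s₃₂ + s₃₄ + s₄₁ + s₄₂ + s₄₃)
  · linear_combination mul_mul_le_of_eq (e₁ x) (e₄ y) (mul_nonneg k₂ k₃) + t +
      2 * (s₁₂ + s₁₃ + s₂₁ + s₂₃ + s₂₄ + s₃₁ + s₃₂ + s₃₄ + s₄₂ + s₄₃)
  · linear_combination mul_mul_le_of_eq (e₂ x) (e₃ y) (mul_nonneg k₁ k₄) + t +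
      2 * (s₁₂ + s₁₃ + s₁₄ + s₂₁ + s₂₄ + s₃₁ + s₃₄ + s₄₁ + s₄₂ + s₄₃)
  · linear_combination mul_mul_le_of_eq (e₂ x) (e₄ y) (mul_nonneg k₁ k₃) + t +
      2 * (s₁₂ + s₁₃ + s₁₄ + s₂₁ + s₂₃ + s₃₁ + s₃₂ + s₃₄ + s₄₁ + s₄₃)
  · linear_combination mul_mul_le_of_eq (e₃ x) (e₄ y) (mul_nonneg k₁ k₂) + t +
      2 * (s₁₂ + s₁₃ + s₁₄ + s₂₁ + s₂₃ + s₂₄ + s₃₁ + s₃₂ + s₄₁ + s₄₂)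

lemma edgeWeight_prod_le {n : ℕ} (hn : 7 ≤ n) {u a b e : Vx n} (h : IsBadQuadruple n u a b e) :
    edgeWeight n u a * edgeWeight n a b * edgeWeight n b e * edgeWeight n e u ≤
      pathWeight n u a b e + pathWeight n u e b a + pathWeight n a u e b +
        pathWeight n e u a b := by
  have hn3 : 3 ≤ n := by omega
  have p₁ := pathWeight_nonneg hn3 u a b e
  have p₂ := pathWeight_nonneg hn3 u e b a
  have p₃ := pathWeight_nonneg hn3 a u e b
  have p₄ := pathWeight_nonneg hn3 e u a b
  have hbad := h.2.2
  by_cases hpair : (tdist n u a = 1 ∨ tdist n a b = 1) ∧ (tdist n u a = 1 ∨ tdist n b e = 1) ∧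
      (tdist n u a = 1 ∨ tdist n e u = 1) ∧ (tdist n a b = 1 ∨ tdist n b e = 1) ∧
      (tdist n a b = 1 ∨ tdist n e u = 1) ∧ (tdist n b e = 1 ∨ tdist n e u = 1)
  · have c₁ := edgeWeight_comm n u a
    have c₂ := edgeWeight_comm n a b
    have c₃ := edgeWeight_comm n b e
    have c₄ := edgeWeight_comm n e u
    by_cases q₁ : tdist n u a = 1
    · by_cases q₂ : tdist n a b = 1
      · by_cases q₃ : tdist n b e = 1
        · have := edgeWeight_prod_le_pathWeight hn q₁ q₂ q₃ fun q₄ => hbad ⟨q₁, q₂, q₃, q₄⟩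
          linarith
        · have q₄ : tdist n e u = 1 := hpair.2.2.2.2.2.resolve_left q₃
          have := edgeWeight_prod_le_pathWeight hn q₄ q₁ q₂ q₃
          linarith
      · have q₃ : tdist n b e = 1 := hpair.2.2.2.1.resolve_left q₂
        have q₄ : tdist n e u = 1 := hpair.2.2.2.2.1.resolve_left q₂
        rw [tdist_comm] at q₁ q₂ q₃ q₄
        have := edgeWeight_prod_le_pathWeight hn q₁ q₄ q₃ q₂
        rw [← c₁, ← c₂, ← c₃, ← c₄] at this
        linarith
    · have q₂ : tdist n a b = 1 := hpair.1.resolve_left q₁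
      have q₃ : tdist n b e = 1 := hpair.2.1.resolve_left q₁
      have q₄ : tdist n e u = 1 := hpair.2.2.1.resolve_left q₁
      rw [tdist_comm] at q₁ q₂ q₃ q₄
      have := edgeWeight_prod_le_pathWeight hn q₄ q₃ q₂ q₁
      rw [← c₁, ← c₂, ← c₃, ← c₄] at this
      linarith
  · clear p₁ p₂ p₃ p₄ hbad h
    unfold pathWeight
    rw [edgeWeight_comm n u e, edgeWeight_comm n e b, edgeWeight_comm n b a, edgeWeight_comm n a u,
      farWeight_comm n u e, farWeight_comm n e b, farWeight_comm n b a, farWeight_comm n a u,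
      nearWeight_comm n u e, nearWeight_comm n e b, nearWeight_comm n b a, nearWeight_comm n a u]
    have n₁ := nearWeight_nonneg n u a
    have n₂ := nearWeight_nonneg n a b
    have n₃ := nearWeight_nonneg n b e
    have n₄ := nearWeight_nonneg n e u
    have k₁ := edgeWeight_nonneg hn3 u a
    have k₂ := edgeWeight_nonneg hn3 a b
    have k₃ := edgeWeight_nonneg hn3 b e
    have k₄ := edgeWeight_nonneg hn3 e u
    have e₁ := edgeWeight_eq_of_ne (n := n) (x := u) (y := a)
    have e₂ := edgeWeight_eq_of_ne (n := n) (x := a) (y := b)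
    have e₃ := edgeWeight_eq_of_ne (n := n) (x := b) (y := e)
    have e₄ := edgeWeight_eq_of_ne (n := n) (x := e) (y := u)
    have hZ := (normFactor_pos hn3).le
    exact four_cycle_bound_of_two hZ n₁ n₂ n₃ n₄ k₁ k₂ k₃ k₄ e₁ e₂ e₃ e₄ hpair

lemma Pr_badCycleEvent_le_normFactor {n : ℕ} (hn : 7 ≤ n) (u : Vx n) :
    Pr n (badCycleEvent n u) ≤ 256 / 9 * normFactor n + 432 * normFactor n ^ 2 := by
  have hn3 : 3 ≤ n := by omega
  have h := two_mul_Pr_badCycleEvent_le hn3 u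
  have hle : (∑ a, ∑ b, ∑ e, if IsBadQuadruple n u a b e then
      edgeWeight n u a * edgeWeight n a b * edgeWeight n b e * edgeWeight n e u else 0) ≤
      ∑ a, ∑ b, ∑ e, (pathWeight n u a b e + pathWeight n u e b a + pathWeight n a u e b +
        pathWeight n e u a b) := by
    refine Finset.sum_le_sum fun a _ => Finset.sum_le_sum fun b _ => Finset.sum_le_sum fun e _ => ?_
    split_ifs with hbad
    · exact edgeWeight_prod_le hn hbad
    · have := pathWeight_nonneg hn3 u a b e
      have := pathWeight_nonneg hn3 u e b a
      have := pathWeight_nonneg hn3 a u e b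
      have := pathWeight_nonneg hn3 e u a b
      positivity
  simp only [Finset.sum_add_distrib] at hle
  have h₁ := sum_pathWeight_chain_le hn3 u
  have h₂ := sum_pathWeight_fork_le hn3 u
  have h₃ := sum_reverse fun a b e => pathWeight n u a b e
  have h₄ := sum_reverse fun a b e => pathWeight n a u e b
  linarith

lemma Pr_badCycleEvent_le {n : ℕ} (hn : 7 ≤ n) (u : Vx n) :
    Pr n (badCycleEvent n u) ≤
      64 / 9 * (Real.log ((n : ℝ) / 2))⁻¹ + 27 * (Real.log ((n : ℝ) / 2) ^ 2)⁻¹ := by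
  have hn' : (7 : ℝ) ≤ n := by exact_mod_cast hn
  have hL : 0 < Real.log ((n : ℝ) / 2) := Real.log_pos (by linarith)
  have hz := normFactor_pos (n := n) (by omega)
  have hle : normFactor n ≤ (Real.log ((n : ℝ) / 2))⁻¹ / 4 := by
    have := inv_anti₀ (by positivity) (four_mul_log_le (n := n) (by omega))
    rw [inv_inv, mul_inv] at this
    linarith
  refine (Pr_badCycleEvent_le_normFactor hn u).trans ?_
  have hsq := pow_le_pow_left₀ hz.le hle 2
  rw [div_pow, inv_pow] at hsq
  linarith

lemma one_le_zeta3 : 1 ≤ zeta3 := by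
  have hs : Summable fun i : ℕ => ((i + 1 : ℝ) ^ 3)⁻¹ := by
    have := (summable_nat_add_iff 1).2 (Real.summable_nat_pow_inv.2 (by norm_num : 1 < 3))
    simpa using this
  have := hs.sum_le_tsum {0} fun i _ => by positivity
  simpa [zeta3] using this

lemma seven_le_of_lt_log {n : ℕ} (h : 70 / 9 < Real.log ((n : ℝ) / 2)) : 7 ≤ n := by
  by_contra hn
  have hn : (n : ℝ) ≤ 6 := by exact_mod_cast (by omega : n ≤ 6)
  have := Real.log_le_self (show (0 : ℝ) ≤ (n : ℝ) / 2 by positivity)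
  linarith

/-- Explicit bound on `Pr(E_u)`; in particular `Pr(E_u) = O(1 / log n)`. -/
theorem prob_badCycleEvent :
    (∀ n : ℕ, 3 ≤ n → ∀ u : Vx n,
      Pr n (badCycleEvent n u) <
        (70 / 9) * (Real.log ((n : ℝ) / 2))⁻¹ +
        ((65 / 2) * zeta3 + 403 / 128) * (Real.log ((n : ℝ) / 2) ^ 2)⁻¹ +
        (24 * zeta3 + 8) * (Real.log (n : ℝ) + 1) * (Real.log ((n : ℝ) / 2) ^ 3)⁻¹ +
        ((3 / 4) * zeta3 + 1 / 4) * (Real.log (n : ℝ) + 1) ^ 2 * (Real.log ((n : ℝ) / 2) ^ 4)⁻¹) ∧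
    ∃ C > (0 : ℝ), ∀ n : ℕ, 3 ≤ n → ∀ u : Vx n,
      Pr n (badCycleEvent n u) ≤ C / Real.log (n : ℝ) := by
  refine ⟨fun n hn u => ?_, 22, by norm_num, fun n hn u => ?_⟩
  all_goals
    have hn' : (3 : ℝ) ≤ n := by exact_mod_cast hn
    have hL : 0 < Real.log ((n : ℝ) / 2) := Real.log_pos (by linarith)
    have hlogn : 0 < Real.log (n : ℝ) := Real.log_pos (by linarith)
  · have hz := one_le_zeta3
    have hz₀ : 0 < zeta3 := by linarith
    have hLi := inv_pos.2 hL
    have h₂ : 0 ≤ (Real.log ((n : ℝ) / 2) ^ 2)⁻¹ := by positivity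
    have hz₂ := mul_le_mul_of_nonneg_right hz h₂
    have h₃ : 0 < (24 * zeta3 + 8) * (Real.log (n : ℝ) + 1) *
        (Real.log ((n : ℝ) / 2) ^ 3)⁻¹ := by positivity
    have h₄ : 0 < ((3 / 4) * zeta3 + 1 / 4) * (Real.log (n : ℝ) + 1) ^ 2 *
        (Real.log ((n : ℝ) / 2) ^ 4)⁻¹ := by positivity
    rcases le_or_gt (Real.log ((n : ℝ) / 2)) (70 / 9) with h | h
    · have h₁ := Pr_le_one hn (badCycleEvent n u)
      have : 1 ≤ 70 / 9 * (Real.log ((n : ℝ) / 2))⁻¹ := by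
        rw [← div_eq_mul_inv, le_div_iff₀ hL]; linarith
      linarith
    · have := Pr_badCycleEvent_le (seven_le_of_lt_log h) u
      linarith
  · have hlog : Real.log (n : ℝ) ≤ Real.log ((n : ℝ) / 2) + 1 := by
      rw [Real.log_div (by positivity) two_ne_zero]
      linarith [Real.log_two_lt_d9]
    rw [le_div_iff₀ hlogn]
    rcases le_or_gt (Real.log ((n : ℝ) / 2)) (70 / 9) with h | h
    · nlinarith [Pr_le_one hn (badCycleEvent n u)]
    · have hPr := Pr_badCycleEvent_le (seven_le_of_lt_log h) u
      set L := Real.log ((n : ℝ) / 2)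
      calc Pr n (badCycleEvent n u) * Real.log (n : ℝ)
          ≤ (64 / 9 * L⁻¹ + 27 * (L ^ 2)⁻¹) * (2 * L) :=
            mul_le_mul hPr (by linarith) hlogn.le (by positivity)
        _ = 128 / 9 + 54 / L := by field_simp; ring
        _ ≤ 128 / 9 + 54 / (70 / 9) := by gcongr
        _ ≤ 22 := by norm_num
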